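/- (Knuth's conjecture, proved by Igusa and Bentz) For n = k(k+1)/2 and any partition λ of n, B^{k(k-1)}(λ) = (k, k-1, ..., 2, 1). -/

import Mathlib

/-- A partition of `n`: a multiset of positive integers summing to `n`
(multisets model nonincreasing sequences, since order is irrelevant). -/
def IsPartition (n : ℕ) (l : Multiset ℕ) : Prop :=
  l.sum = n ∧ ∀ x ∈ l, 0 < x

/-- The Bulgarian solitaire move: remove one card from each pile, discard empty
piles, and add a new pile whose size is the number of old piles. -/
def bulg (l : Multiset ℕ) : Multiset ℕ :=
  (Multiset.card l ::ₘ l.map (· - 1)).filter (0 < ·)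

/-- The staircase partition `(k, k-1, …, 2, 1)`. -/
def staircase (k : ℕ) : Multiset ℕ := (Multiset.range k).map (· + 1)

/-- The number of parts of `l` exceeding `i`. -/
def numGT (l : Multiset ℕ) (i : ℕ) : ℕ := l.countP (i < ·)

theorem numGT_zero {l : Multiset ℕ} (hl : ∀ x ∈ l, 0 < x) : numGT l 0 = Multiset.card l :=
  Multiset.countP_eq_card.2 hl

theorem numGT_bulg (l : Multiset ℕ) (i : ℕ) :
    numGT (bulg l) i = numGT l (i + 1) + if i < Multiset.card l then 1 else 0 := by
  unfold numGT bulg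
  rw [Multiset.countP_filter, Multiset.countP_cons, Multiset.countP_map,
    Multiset.countP_eq_card_filter]
  congr 1
  · congr 1
    refine Multiset.filter_congr fun x _ => ?_
    omega
  · refine if_congr ?_ rfl rfl
    omega

theorem sum_eq_sum_numGT (l : Multiset ℕ) (N : ℕ) (h : ∀ x ∈ l, x ≤ N) :
    l.sum = ∑ i ∈ Finset.range N, numGT l i := by
  induction l using Multiset.induction with
  | empty => simp [numGT]
  | cons a l ih =>
    have ha : a ≤ N := h a (Multiset.mem_cons_self a l)
    have hcard : ∑ i ∈ Finset.range N, (if i < a then 1 else 0) = a := by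
      rw [Finset.sum_boole, Nat.cast_id]
      have : (Finset.range N).filter (· < a) = Finset.range a := by
        ext i
        simp only [Finset.mem_filter, Finset.mem_range]
        omega
      rw [this, Finset.card_range]
    rw [Multiset.sum_cons, ih fun x hx => h x (Multiset.mem_cons_of_mem hx)]
    simp only [numGT, Multiset.countP_cons, Finset.sum_add_distrib]
    rw [hcard, add_comm]

theorem isPartition_bulg {n : ℕ} {l : Multiset ℕ} (hl : IsPartition n l) :
    IsPartition n (bulg l) := by
  refine ⟨?_, fun x hx => (Multiset.mem_filter.1 hx).2⟩
  have hfilter (m : Multiset ℕ) : (m.filter (0 < ·)).sum = m.sum := by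
    induction m using Multiset.induction with
    | empty => simp
    | cons a m ih =>
      by_cases ha : 0 < a
      · simp [ha, ih]
      · simp [ih, Nat.eq_zero_of_not_pos ha]
  have hpred (m : Multiset ℕ) (hm : ∀ x ∈ m, 0 < x) :
      Multiset.card m + (m.map (· - 1)).sum = m.sum := by
    induction m using Multiset.induction with
    | empty => simp
    | cons a m ih =>
      have ha := hm a (Multiset.mem_cons_self a m)
      have := ih fun x hx => hm x (Multiset.mem_cons_of_mem hx)
      simp only [Multiset.card_cons, Multiset.map_cons, Multiset.sum_cons]
      omega
  rw [bulg, hfilter, Multiset.sum_cons, hpred l hl.2, hl.1]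

theorem IsPartition.iterate_bulg {n : ℕ} {l : Multiset ℕ} (hl : IsPartition n l) (t : ℕ) :
    IsPartition n (bulg^[t] l) := by
  induction t with
  | zero => exact hl
  | succ t ih => rw [Function.iterate_succ_apply']; exact isPartition_bulg ih

theorem IsPartition.le {n : ℕ} {l : Multiset ℕ} (hl : IsPartition n l) :
    ∀ x ∈ l, x ≤ n := fun _ hx => hl.1 ▸ Multiset.le_sum_of_mem hx

theorem IsPartition.eq_of_numGT_eq {n m : ℕ} {l l' : Multiset ℕ} (hl : IsPartition n l)
    (hl' : IsPartition m l') (h : ∀ i, numGT l i = numGT l' i) : l = l' := by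
  have hcount (r : Multiset ℕ) (a : ℕ) : r.count (a + 1) + numGT r (a + 1) = numGT r a := by
    unfold numGT
    induction r using Multiset.induction with
    | empty => simp
    | cons b r ih =>
      simp only [Multiset.count_cons, Multiset.countP_cons]
      split_ifs <;> omega
  ext a
  cases a with
  | zero =>
    rw [Multiset.count_eq_zero.2 fun h0 => (hl.2 0 h0).false,
      Multiset.count_eq_zero.2 fun h0 => (hl'.2 0 h0).false]
  | succ a =>
    have h1 := hcount l a
    have h2 := hcount l' a
    rw [h a, h (a + 1)] at h1
    omega

theorem staircase_succ (k : ℕ) : staircase (k + 1) = (k + 1) ::ₘ staircase k := by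
  simp [staircase, Multiset.range_succ]

theorem numGT_staircase (k i : ℕ) : numGT (staircase k) i = k - i := by
  induction k with
  | zero => simp [numGT, staircase]
  | succ k ih =>
    unfold numGT at ih ⊢
    rw [staircase_succ, Multiset.countP_cons, ih]
    split_ifs <;> omega

theorem isPartition_staircase (k : ℕ) : IsPartition (k * (k + 1) / 2) (staircase k) := by
  refine ⟨?_, fun x hx => ?_⟩
  · have h2 : (staircase k).sum * 2 = k * (k + 1) := by
      induction k with
      | zero => simp [staircase]
      | succ k ih => rw [staircase_succ, Multiset.sum_cons, add_mul, ih]; ring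
    omega
  · obtain ⟨y, -, rfl⟩ := Multiset.mem_map.1 hx
    exact Nat.succ_pos y

theorem IsPartition.exists_lt_numGT {k : ℕ} {l : Multiset ℕ}
    (hl : IsPartition (k * (k + 1) / 2) l) (hne : ∃ i, numGT l i ≠ k - i) :
    ∃ i, k - i < numGT l i := by
  by_contra! hle
  obtain ⟨j, hj⟩ := hne
  have hs := isPartition_staircase k
  set n := k * (k + 1) / 2
  have h1 := sum_eq_sum_numGT l (n + j + 1) fun x hx => (hl.le x hx).trans (by omega)
  have h2 := sum_eq_sum_numGT (staircase k) (n + j + 1)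
    fun x hx => (hs.le x hx).trans (by omega)
  have := Finset.sum_lt_sum (s := Finset.range (n + j + 1)) (f := numGT l)
    (g := numGT (staircase k)) (fun i _ => (hle i).trans_eq (numGT_staircase k i).symm)
    ⟨j, by simp, by rw [numGT_staircase]; exact lt_of_le_of_ne (hle j) hj⟩
  rw [← h1, ← h2, hl.1, hs.1] at this
  exact this.false

theorem IsPartition.numGT_eq_of_le {k : ℕ} {l : Multiset ℕ}
    (hl : IsPartition (k * (k + 1) / 2) l) (hge : ∀ i, k - i ≤ numGT l i) (j : ℕ) :
    numGT l j = k - j := by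
  by_contra hj
  have hs := isPartition_staircase k
  set n := k * (k + 1) / 2
  have h1 := sum_eq_sum_numGT l (n + j + 1) fun x hx => (hl.le x hx).trans (by omega)
  have h2 := sum_eq_sum_numGT (staircase k) (n + j + 1)
    fun x hx => (hs.le x hx).trans (by omega)
  have := Finset.sum_lt_sum (s := Finset.range (n + j + 1)) (f := numGT (staircase k))
    (g := numGT l) (fun i _ => (numGT_staircase k i).trans_le (hge i))
    ⟨j, by simp, by rw [numGT_staircase]; exact lt_of_le_of_ne (hge j) (Ne.symm hj)⟩
  rw [← h1, ← h2, hl.1, hs.1] at this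
  exact this.false

theorem numGT_iterate_bulg (l : Multiset ℕ) (t i : ℕ) :
    numGT (bulg^[t] l) i = numGT l (t + i) +
      ((Finset.range t).filter fun s => t + i ≤ s + Multiset.card (bulg^[s] l)).card := by
  induction t generalizing i with
  | zero => simp
  | succ t ih =>
    rw [Function.iterate_succ_apply', numGT_bulg, ih, Finset.range_add_one,
      Finset.filter_insert]
    have h : t + (i + 1) = t + 1 + i := by ring
    rw [h]
    split_ifs with h1 h2 h2
    · rw [Finset.card_insert_of_notMem (by simp)]; ring
    · omega
    · omega
    · ring

/-- `c` is the sequence of pile counts of a solitaire orbit in which `q t` of the initial piles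
survive for `t` moves: the pile created by move `s` has size `c s`. -/
structure IsCountSeq (c q : ℕ → ℕ) : Prop where
  antitone : Antitone q
  eq_add_card : ∀ t, c t = q t + ((Finset.range t).filter fun s => t ≤ s + c s).card

namespace IsCountSeq

variable {c q : ℕ → ℕ}

theorem exists_last_expired (h : IsCountSeq c q) {k t : ℕ} (hlow : c t < k) (hkt : k ≤ t) :
    ∃ r < t, t ≤ r + k ∧ r + c r < t ∧ ∀ s, r < s → s < t → t ≤ s + c s := by
  have hne : ((Finset.Ico (t - k) t).filter fun s => s + c s < t).Nonempty := by
    by_contra hempty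
    rw [Finset.not_nonempty_iff_eq_empty, Finset.filter_eq_empty_iff] at hempty
    have hsub : Finset.Ico (t - k) t ⊆ (Finset.range t).filter fun s => t ≤ s + c s := by
      intro s hs
      have := hempty hs
      simp only [Finset.mem_filter, Finset.mem_range, Finset.mem_Ico] at hs ⊢
      omega
    have hcard := Finset.card_le_card hsub
    rw [Nat.card_Ico] at hcard
    have := h.eq_add_card t
    omega
  obtain ⟨r, hr, hmax⟩ := Finset.exists_max_image _ id hne
  simp only [Finset.mem_filter, Finset.mem_Ico, id] at hr hmax
  refine ⟨r, hr.1.2, by omega, hr.2, fun s hrs hst => ?_⟩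
  by_contra hs
  have := hmax s ⟨⟨by omega, hst⟩, by omega⟩
  omega

theorem add_card_expiring_le (h : IsCountSeq c q) {t u : ℕ} (htu : t < u) :
    c u + ((Finset.range u).filter fun s => t ≤ s + c s ∧ s + c s < u).card ≤ c t + (u - t) := by
  have h1 : ((Finset.range u).filter fun s => t ≤ s + c s).card
      = ((Finset.range u).filter fun s => u ≤ s + c s).card +
        ((Finset.range u).filter fun s => t ≤ s + c s ∧ s + c s < u).card := by
    rw [← Finset.card_union_of_disjoint]
    · congr 1
      ext s
      simp only [Finset.mem_filter, Finset.mem_union, Finset.mem_range]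
      omega
    · rw [Finset.disjoint_left]
      intro s
      simp only [Finset.mem_filter]
      omega
  have h2 : ((Finset.range u).filter fun s => t ≤ s + c s).card
      ≤ ((Finset.range t).filter fun s => t ≤ s + c s).card + (u - t) := by
    rw [← Nat.card_Ico t u]
    refine (Finset.card_le_card fun s hs => ?_).trans (Finset.card_union_le _ _)
    simp only [Finset.mem_filter, Finset.mem_union, Finset.mem_range, Finset.mem_Ico] at hs ⊢
    omega
  have := h.eq_add_card t
  have := h.eq_add_card u
  have := h.antitone htu.le
  omega

/-- A rise of the pile count from below `k` to above `k` in `u - t` moves can only start before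
time `k * (u - t - 1)`. -/
theorem lt_mul_of_lt_of_lt (h : IsCountSeq c q) {k t u : ℕ} (hlow : c t < k) (hhigh : k < c u)
    (htu : t < u) : t < k * (u - t - 1) := by
  induction t using Nat.strong_induction_on generalizing k u with
  | _ t ih =>
    by_contra! hle
    have hstrip := h.add_card_expiring_le htu
    obtain ⟨d, rfl⟩ : ∃ d, u = t + d + 2 := by
      refine ⟨u - t - 2, ?_⟩
      omega
    have hd : t + d + 2 - t - 1 = d + 1 := by omega
    rw [hd] at hle
    have hkt : k ≤ t := le_trans (Nat.le_mul_of_pos_right k d.succ_pos) hle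
    obtain ⟨r, hrt, htr, hrexp, hlast⟩ := h.exists_last_expired hlow hkt
    obtain ⟨v, hrv, hvr, hv⟩ : ∃ v, r < v ∧ v ≤ r + d + 1 ∧ t + d + 2 ≤ v + c v := by
      by_contra! hno
      have hsub : Finset.Ioc r (r + d + 1) ⊆ (Finset.range (t + d + 2)).filter
          fun s => t ≤ s + c s ∧ s + c s < t + d + 2 := by
        intro s hs
        simp only [Finset.mem_Ioc, Finset.mem_filter, Finset.mem_range] at hs ⊢
        refine ⟨by omega, ?_, hno s hs.1 hs.2⟩
        rcases lt_or_ge s t with hst | hst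
        · exact hlast s hs.1 hst
        · omega
      have hcard := Finset.card_le_card hsub
      rw [Nat.card_Ioc] at hcard
      omega
    obtain ⟨a, rfl⟩ := Nat.exists_eq_add_of_lt hrt
    obtain ⟨e, rfl⟩ := Nat.exists_eq_add_of_lt hrv
    have hlt := ih r hrt (k := a + 1) (u := r + e + 1) (by omega) (by omega) (by omega)
    have he : r + e + 1 - r - 1 = e := by omega
    rw [he] at hlt
    have hak : a + 1 ≤ k := by omega
    have h1 : (a + 1) * (d + 1) ≤ k * (d + 1) := Nat.mul_le_mul_right _ hak
    have h2 : (a + 1) * e ≤ (a + 1) * d := Nat.mul_le_mul_left _ (by omega)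
    linarith

end IsCountSeq

theorem IsPartition.isCountSeq {n : ℕ} {l : Multiset ℕ} (hl : IsPartition n l) :
    IsCountSeq (fun t => Multiset.card (bulg^[t] l)) (numGT l) where
  antitone i j hij := by
    unfold numGT
    rw [Multiset.countP_eq_card_filter, Multiset.countP_eq_card_filter]
    exact Multiset.card_le_card
      (Multiset.monotone_filter_right _ fun x hx => lt_of_le_of_lt hij hx)
  eq_add_card t := by
    have := numGT_iterate_bulg l t 0
    rwa [numGT_zero (hl.iterate_bulg t).2] at this

theorem numGT_eq_zero_of_le {n : ℕ} {l : Multiset ℕ} (hl : IsPartition n l) {i : ℕ}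
    (hi : n ≤ i) : numGT l i = 0 :=
  Multiset.countP_eq_zero.2 fun x hx => not_lt.2 ((hl.le x hx).trans hi)

section Triangular

variable {k : ℕ} {l : Multiset ℕ}

theorem exists_le_card_iterate_bulg (hl : IsPartition (k * (k + 1) / 2) l) (hk : 0 < k) (t : ℕ) :
    ∃ s ≥ t, k ≤ Multiset.card (bulg^[s] l) := by
  by_contra! hlow
  set n := k * (k + 1) / 2
  obtain ⟨i, hi⟩ := (hl.iterate_bulg (t + n + k)).exists_lt_numGT ⟨0, by
    rw [numGT_zero (hl.iterate_bulg _).2]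
    have := hlow (t + n + k) (by omega)
    omega⟩
  rw [numGT_iterate_bulg, numGT_eq_zero_of_le hl (by omega), zero_add] at hi
  have hsub : ((Finset.range (t + n + k)).filter fun s =>
      t + n + k + i ≤ s + Multiset.card (bulg^[s] l)) ⊆
      Finset.Ico (t + n + i) (t + n + k) := by
    intro s hs
    simp only [Finset.mem_filter, Finset.mem_range, Finset.mem_Ico] at hs ⊢
    refine ⟨?_, hs.1⟩
    rcases lt_or_ge s t with hst | hst
    · have hcard : Multiset.card (bulg^[s] l) ≤ n := by
        have hp := hl.iterate_bulg s
        have := Multiset.card_nsmul_le_sum (s := bulg^[s] l) (a := 1) fun x hx => hp.2 x hx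
        rw [hp.1] at this
        simpa using this
      omega
    · have := hlow s hst
      omega
  have hcard := Finset.card_le_card hsub
  rw [Nat.card_Ico] at hcard
  omega

theorem card_iterate_bulg_succ_lt (hl : IsPartition (k * (k + 1) / 2) l) (hk : 2 ≤ k) {t : ℕ}
    (ht : k * (k - 1) ≤ t) (hlow : Multiset.card (bulg^[t] l) < k) :
    Multiset.card (bulg^[t + 1] l) < k := by
  by_contra! hnext
  have hc := hl.isCountSeq
  obtain ⟨k, rfl⟩ := Nat.exists_eq_add_of_le' hk
  have hsub1 : k + 2 - 1 = k + 1 := by omega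
  rw [hsub1] at ht
  obtain ⟨r, hrt, htr, hrexp, hlast⟩ := hc.exists_last_expired hlow (by nlinarith)
  rcases htr.lt_or_eq with htr | htr
  · obtain ⟨a, rfl⟩ := Nat.exists_eq_add_of_lt hrt
    have hlt := hc.lt_mul_of_lt_of_lt (k := a + 1) (t := r) (u := r + a + 1 + 1)
      (by omega) (by omega) (by omega)
    have ha : r + a + 1 + 1 - r - 1 = a + 1 := by omega
    rw [ha] at hlt
    have h1 : (a + 1) * (a + 2) ≤ (k + 1) * (k + 2) := Nat.mul_le_mul (by omega) (by omega)
    nlinarith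
  · subst htr
    have hhigh (s : ℕ) (hrs : r < s) (hst : s < r + (k + 2)) :
        Multiset.card (bulg^[s] l) ≤ k + 2 := by
      by_contra! hs
      have hlt := hc.lt_mul_of_lt_of_lt (k := k + 2) (t := r) (u := s)
        (by omega) hs hrs
      have : (k + 2) * (s - r - 1) ≤ (k + 2) * k := Nat.mul_le_mul_left _ (by omega)
      nlinarith
    have hcount := hc.eq_add_card (r + (k + 2))
    have hsub : Finset.Ioo r (r + (k + 2)) ⊆ (Finset.range (r + (k + 2))).filter
        fun s => r + (k + 2) ≤ s + Multiset.card (bulg^[s] l) := by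
      intro s hs
      simp only [Finset.mem_filter, Finset.mem_range, Finset.mem_Ioo] at hs ⊢
      exact ⟨hs.2, hlast s hs.1 hs.2⟩
    have hcard := Finset.card_le_card hsub
    rw [Nat.card_Ioo] at hcard
    have heq := Finset.eq_of_subset_of_card_le hsub (by rw [Nat.card_Ioo]; omega)
    obtain ⟨i, hi⟩ := (hl.iterate_bulg (r + (k + 2))).exists_lt_numGT ⟨0, by
      rw [numGT_zero (hl.iterate_bulg _).2]
      omega⟩
    have hq : numGT l (r + (k + 2) + i) ≤ numGT l (r + (k + 2)) := hc.antitone (by omega)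
    rw [numGT_iterate_bulg] at hi
    have hsub' : ((Finset.range (r + (k + 2))).filter fun s =>
        r + (k + 2) + i ≤ s + Multiset.card (bulg^[s] l)) ⊆
        Finset.Ico (r + i) (r + (k + 2)) := by
      intro s hs
      have hmem : s ∈ Finset.Ioo r (r + (k + 2)) := by
        rw [heq]
        simp only [Finset.mem_filter, Finset.mem_range] at hs ⊢
        omega
      simp only [Finset.mem_filter, Finset.mem_range, Finset.mem_Ico, Finset.mem_Ioo] at hs hmem ⊢
      have := hhigh s hmem.1 hmem.2
      omega
    have hcard' := Finset.card_le_card hsub'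
    rw [Nat.card_Ico] at hcard'
    omega

theorem le_card_iterate_bulg (hl : IsPartition (k * (k + 1) / 2) l) (hk : 2 ≤ k) {t : ℕ}
    (ht : k * (k - 1) ≤ t) : k ≤ Multiset.card (bulg^[t] l) := by
  by_contra! hlow
  obtain ⟨s, hts, hs⟩ := exists_le_card_iterate_bulg hl (by omega) t
  induction s, hts using Nat.le_induction with
  | base => omega
  | succ s hts ih =>
    by_cases h : k ≤ Multiset.card (bulg^[s] l)
    · exact ih h
    · have := card_iterate_bulg_succ_lt hl hk (ht.trans hts) (not_le.1 h)
      omega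

theorem numGT_eq_of_numGT_bulg_eq (hl : IsPartition (k * (k + 1) / 2) l)
    (hk : k ≤ Multiset.card l) (h : ∀ i, numGT (bulg l) i = k - i) (i : ℕ) :
    numGT l i = k - i := by
  cases i with
  | zero =>
    rw [numGT_zero hl.2]
    have := numGT_bulg l k
    rw [h k] at this
    split_ifs at this <;> omega
  | succ i =>
    have := numGT_bulg l i
    rw [h i] at this
    split_ifs at this <;> omega

theorem eq_staircase_of_le_card_iterate_bulg (hl : IsPartition (k * (k + 1) / 2) l)
    (h : ∀ s, k ≤ Multiset.card (bulg^[s] l)) : l = staircase k := by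
  have hend (i : ℕ) : numGT (bulg^[k] l) i = k - i := by
    refine (hl.iterate_bulg k).numGT_eq_of_le (fun j => ?_) i
    rw [numGT_iterate_bulg]
    have hsub : Finset.Ico j k ⊆ (Finset.range k).filter
        fun s => k + j ≤ s + Multiset.card (bulg^[s] l) := by
      intro s hs
      have := h s
      simp only [Finset.mem_filter, Finset.mem_range, Finset.mem_Ico] at hs ⊢
      omega
    have hcard := Finset.card_le_card hsub
    rw [Nat.card_Ico] at hcard
    omega
  have hback (t : ℕ) (ht : ∀ i, numGT (bulg^[t] l) i = k - i) : ∀ i, numGT l i = k - i := by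
    induction t with
    | zero => exact ht
    | succ t ih =>
      refine ih (numGT_eq_of_numGT_bulg_eq (hl.iterate_bulg t) (h t) ?_)
      rwa [Function.iterate_succ_apply'] at ht
  exact hl.eq_of_numGT_eq (isPartition_staircase k) fun i => by
    rw [hback k hend, numGT_staircase]

end Triangular

/-- Knuth's conjecture (proved by Igusa and Bentz): for n = k(k+1)/2, every
partition of n reaches the staircase after k(k-1) moves. -/
theorem knuth_conjecture (k n : ℕ) (hn : n = k * (k + 1) / 2)
    (l : Multiset ℕ) (hl : IsPartition n l) :
    bulg^[k * (k - 1)] l = staircase k := by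
  subst hn
  refine eq_staircase_of_le_card_iterate_bulg (hl.iterate_bulg _) fun s => ?_
  rw [← Function.iterate_add_apply]
  rcases lt_or_ge k 2 with hk | hk
  · interval_cases k
    · exact Nat.zero_le _
    · have hp := hl.iterate_bulg (s + 1 * (1 - 1))
      rw [Nat.one_le_iff_ne_zero, Ne, Multiset.card_eq_zero]
      intro h0
      have hsum := hp.1
      rw [h0] at hsum
      simp at hsum
  · exact le_card_iterate_bulg hl hk (by omega)
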